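/- Let D = (V+r, E) be a rooted digraph. Then the subflames of D form a greedoid on the ground set E; that is, the empty edge set is a subflame, and for any two subflames F₁, F₂ ⊆ E with |F₁| < |F₂| there exists an edge e ∈ F₂ \ F₁ such that F₁ + e is also a subflame. -/

import Mathlib

/- Common setup: a rooted digraph `D = (V+r, E)` is modelled as a finite
vertex type `α` (whose elements are `V ∪ {r}`), a finite edge type `E`
(allowing parallel edges, i.e. a multigraph) and maps `tail head : E → α`.
Subgraphs / edge subsets are sets `F : Set E`; the whole digraph `D`
corresponds to the edge set `Set.univ`.  "`v ∈ V`" is rendered as `v ≠ r`,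
and a vertex subset `X ⊆ V` as `X : Set α` with `r ∉ X`. -/

/-- In-degree of the vertex `v` in the digraph with edge set `F`. -/
noncomputable def inDeg {α E : Type*} (head : E → α) (F : Set E) (v : α) : ℕ :=
  {e ∈ F | head e = v}.ncard

/-- `ϱ_F(X)`: the number of edges of `F` entering the vertex set `X`
(tail outside `X`, head in `X`). -/
noncomputable def rho {α E : Type*} (tail head : E → α) (F : Set E) (X : Set α) : ℕ :=
  {e ∈ F | tail e ∉ X ∧ head e ∈ X}.ncard

/-- `p` is a directed path from `r` to `v` using edges of `F`:
a nonempty list of consecutive edges, starting at `r`, ending at `v`, and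
visiting pairwise distinct vertices. -/
def IsRVPath {α E : Type*} (tail head : E → α) (F : Set E) (r v : α) (p : List E) : Prop :=
  (∀ e ∈ p, e ∈ F) ∧
  List.Chain' (fun e f => head e = tail f) p ∧
  (p.map tail).Nodup ∧ (∀ e ∈ p, tail e ≠ v) ∧
  (∃ e, p.head? = some e ∧ tail e = r) ∧
  (∃ e, p.getLast? = some e ∧ head e = v)

/-- There exist `n` pairwise edge-disjoint directed paths from `r` to `v`
in the edge set `F`. -/
def HasEDPaths {α E : Type*} (tail head : E → α) (F : Set E) (r v : α) (n : ℕ) : Prop :=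
  ∃ P : Fin n → List E, (∀ i, IsRVPath tail head F r v (P i)) ∧
    ∀ i j, i ≠ j → ∀ e, e ∈ P i → e ∉ P j

/-- `λ_F(r,v)`: the local edge-connectivity from `r` to `v`, i.e. the maximum
number of pairwise edge-disjoint directed paths from `r` to `v` in `F`. -/
noncomputable def lam {α E : Type*} (tail head : E → α) (F : Set E) (r v : α) : ℕ :=
  sSup {n | HasEDPaths tail head F r v n}

/-- `X` is a `v`-tight vertex set in the digraph with edge set `F` and root `r`:
`X ⊆ V` (i.e. `r ∉ X`), `v ∈ X` and `ϱ_F(X) = λ_F(r,v)`. -/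
def Tight {α E : Type*} (tail head : E → α) (F : Set E) (r v : α) (X : Set α) : Prop :=
  v ∈ X ∧ r ∉ X ∧ rho tail head F X = lam tail head F r v

/-- The digraph with edge set `F` is a flame with root `r`:
`λ_F(r,v) = ϱ_F(v)` for every `v ∈ V`. -/
def IsFlame {α E : Type*} (tail head : E → α) (F : Set E) (r : α) : Prop :=
  ∀ v, v ≠ r → lam tail head F r v = inDeg head F v

/-- `F` is a maximal flame within the ambient edge set `A`:
`λ_A(r,v) = λ_F(r,v) = ϱ_F(v)` for every `v ∈ V`. -/
def IsMaxFlameIn {α E : Type*} (tail head : E → α) (A : Set E) (r : α) (F : Set E) : Prop :=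
  F ⊆ A ∧ ∀ v, v ≠ r →
    lam tail head A r v = lam tail head F r v ∧
    lam tail head F r v = inDeg head F v

/-- A closed directed walk in `F` with pairwise distinct edges.  (If every
vertex is entered by at most one edge of `F`, the existence of such a walk is
equivalent to the existence of an undirected cycle in `F`.) -/
def IsDicycle {α E : Type*} (tail head : E → α) (F : Set E) (p : List E) : Prop :=
  p.Nodup ∧ (∀ e ∈ p, e ∈ F) ∧
  List.Chain' (fun e f => head e = tail f) p ∧
  (∃ e f, p.head? = some e ∧ p.getLast? = some f ∧ head f = tail e)

/-- `B` is a branching: every vertex is entered by at most one edge of `B` and,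
disregarding edge directions, `B` contains no cycle (under the in-degree
condition this is equivalent to containing no directed cycle). -/
def IsBranching {α E : Type*} (tail head : E → α) (B : Set E) : Prop :=
  (∀ v, inDeg head B v ≤ 1) ∧ ∀ p : List E, ¬ IsDicycle tail head B p

/-- The head-set of an edge set `B`: the vertices entered by an edge of `B`. -/
def headSet {α E : Type*} (head : E → α) (B : Set E) : Set α := {v | ∃ e ∈ B, head e = v}

/-- Independence in the gammoid `G_D(v)` (with `D` the whole digraph, edge set
`Set.univ`): `X ⊆ in_D(v)` is independent if there are `|X|` pairwise
edge-disjoint directed paths from `r` to `v` in `D` whose set of last edges is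
exactly `X`. -/
def GammoidIndep {α E : Type*} (tail head : E → α) (r v : α) (X : Set E) : Prop :=
  ∃ P : Fin X.ncard → List E,
    (∀ i, IsRVPath tail head Set.univ r v (P i)) ∧
    (∀ i j, i ≠ j → ∀ e, e ∈ P i → e ∉ P j) ∧
    (∀ e, e ∈ X ↔ ∃ i, (P i).getLast? = some e)

section Paths

variable {α E : Type*} {tail head : E → α} {F G : Set E} {r v : α}

theorem IsRVPath.mono (h : F ⊆ G) {p : List E} (hp : IsRVPath tail head F r v p) :
    IsRVPath tail head G r v p :=
  ⟨fun e he => h (hp.1 e he), hp.2⟩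

theorem HasEDPaths.mono (h : F ⊆ G) {n : ℕ} (hn : HasEDPaths tail head F r v n) :
    HasEDPaths tail head G r v n := by
  obtain ⟨P, hP, hd⟩ := hn
  exact ⟨P, fun i => (hP i).mono h, hd⟩

/-- A walk starting outside `X` and ending inside `X` has an edge entering `X`. -/
theorem exists_entering_edge {X : Set α} (p : List E)
    (hc : List.IsChain (fun e f => head e = tail f) p)
    (h₁ : ∃ e, p.head? = some e ∧ tail e ∉ X) (h₂ : ∃ e, p.getLast? = some e ∧ head e ∈ X) :
    ∃ e ∈ p, tail e ∉ X ∧ head e ∈ X := by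
  induction p with
  | nil => simp at h₁
  | cons a p ih =>
    have ha : tail a ∉ X := by simpa using h₁
    by_cases hX : head a ∈ X
    · exact ⟨a, by simp, ha, hX⟩
    cases p with
    | nil => simp at h₂; exact absurd h₂ hX
    | cons b q =>
      rw [List.isChain_cons_cons] at hc
      obtain ⟨e, he, h⟩ := ih hc.2 ⟨b, rfl, hc.1 ▸ hX⟩ (by simpa using h₂)
      exact ⟨e, List.mem_cons_of_mem _ he, h⟩

theorem HasEDPaths.le_rho [Finite E] {X : Set α} {n : ℕ} (h : HasEDPaths tail head F r v n)
    (hr : r ∉ X) (hv : v ∈ X) : n ≤ rho tail head F X := by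
  obtain ⟨P, hP, hd⟩ := h
  have hex : ∀ i, ∃ e ∈ P i, tail e ∉ X ∧ head e ∈ X := by
    intro i
    obtain ⟨-, hc, -, -, ⟨a, ha, har⟩, ⟨b, hb, hbv⟩⟩ := hP i
    exact exists_entering_edge _ hc ⟨a, ha, har ▸ hr⟩ ⟨b, hb, hbv ▸ hv⟩
  choose f hf hfX using hex
  have hinj : Function.Injective f := by
    intro i j hij
    by_contra hne
    exact hd i j hne (f i) (hf i) (hij ▸ hf j)
  calc n = (Set.range f).ncard := by
        rw [← Set.image_univ, Set.ncard_image_of_injective _ hinj]; simp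
    _ ≤ _ := Set.ncard_le_ncard (by
        rintro _ ⟨i, rfl⟩
        exact ⟨(hP i).1 _ (hf i), hfX i⟩) (Set.toFinite _)

theorem lam_le_rho [Finite E] {X : Set α} (hr : r ∉ X) (hv : v ∈ X) :
    lam tail head F r v ≤ rho tail head F X :=
  csSup_le ⟨0, Fin.elim0, fun i => i.elim0, fun i => i.elim0⟩ fun _ h => h.le_rho hr hv

theorem HasEDPaths.le_lam [Finite E] (hv : v ≠ r) {n : ℕ} (h : HasEDPaths tail head F r v n) :
    n ≤ lam tail head F r v :=
  le_csSup ⟨_, fun _ h => h.le_rho (X := {v}) (by simpa using hv.symm) rfl⟩ h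

theorem lam_mono [Finite E] (hv : v ≠ r) (h : F ⊆ G) :
    lam tail head F r v ≤ lam tail head G r v :=
  csSup_le ⟨0, Fin.elim0, fun i => i.elim0, fun i => i.elim0⟩ fun _ hn => (hn.mono h).le_lam hv

theorem rho_singleton_le_inDeg [Finite E] : rho tail head F {v} ≤ inDeg head F v :=
  Set.ncard_le_ncard (fun _ he => ⟨he.1, he.2.2⟩) (Set.toFinite _)

theorem lam_le_inDeg [Finite E] (hv : v ≠ r) : lam tail head F r v ≤ inDeg head F v :=
  (lam_le_rho (X := {v}) (by simpa using hv.symm) rfl).trans rho_singleton_le_inDeg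

/-- Reachability along edges of `F` yields a simple path. -/
theorem exists_isRVPath
    (h : Relation.ReflTransGen (fun a b => ∃ e ∈ F, tail e = a ∧ head e = b) r v) (hv : r ≠ v) :
    ∃ p, IsRVPath tail head F r v p := by
  induction h using Relation.ReflTransGen.head_induction_on with
  | refl => exact absurd rfl hv
  | @head a b hab _ ih =>
    obtain ⟨e, heF, rfl, rfl⟩ := hab
    by_cases hb : head e = v
    · exact ⟨[e], by simpa using heF, List.isChain_singleton _, by simp, by simpa using hv, by simp,
        by simpa using hb⟩
    obtain ⟨p, hpF, hpc, hpn, hpv, ⟨f, hf, hft⟩, ⟨g, hg, hgv⟩⟩ := ih hb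
    by_cases hmem : tail e ∈ p.map tail
    · obtain ⟨d, hd, hde⟩ := List.mem_map.1 hmem
      obtain ⟨s, t, rfl⟩ := List.append_of_mem hd
      refine ⟨d :: t, fun x hx => hpF x (List.mem_append_right _ hx),
        (List.isChain_append.1 hpc).2.1, ?_, fun x hx => hpv x (List.mem_append_right _ hx),
        ⟨d, rfl, hde⟩, ⟨g, ?_, hgv⟩⟩
      · rw [List.map_append] at hpn
        exact (List.nodup_append.1 hpn).2.1
      · rwa [List.getLast?_append_of_ne_nil _ (by simp)] at hg
    · refine ⟨e :: p, ?_, ?_, ?_, ?_, ⟨e, rfl, rfl⟩, ⟨g, ?_, hgv⟩⟩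
      · simpa using ⟨heF, hpF⟩
      · refine List.isChain_cons.2 ⟨?_, hpc⟩
        intro y hy
        rw [hf, Option.mem_some_iff] at hy
        rw [← hy, hft]
      · rw [List.map_cons, List.nodup_cons]
        exact ⟨hmem, hpn⟩
      · simpa using ⟨hv, hpv⟩
      · cases p with
        | nil => simp at hf
        | cons x q => simpa using hg

end Paths

section Menger

variable {α E : Type*}

/-- The edges met when iterating `σ` from `Sum.inr i` before returning to the right summand. -/
inductive SegmentFrom {κ : Type*} (σ : E ⊕ κ → E ⊕ κ) (i : κ) : E → Prop
  | base {e : E} : σ (Sum.inr i) = Sum.inl e → SegmentFrom σ i e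
  | step {e f : E} : SegmentFrom σ i e → σ (Sum.inl e) = Sum.inl f → SegmentFrom σ i f

theorem SegmentFrom.eq_of_injective {κ : Type*} {σ : E ⊕ κ → E ⊕ κ} (hσ : Function.Injective σ)
    {i j : κ} {e : E} (hi : SegmentFrom σ i e) (hj : SegmentFrom σ j e) : i = j := by
  induction hi with
  | base h =>
    cases hj with
    | base h' => exact Sum.inr_injective (hσ (h.trans h'.symm))
    | step _ h' => exact absurd (hσ (h.trans h'.symm)) (by simp)
  | step _ h ih =>
    cases hj with
    | base h' => exact absurd (hσ (h.trans h'.symm)) (by simp)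
    | step hs h' =>
      obtain rfl := Sum.inl_injective (hσ (h.trans h'.symm))
      exact ih hs

/-- The successor relation whose perfect matchings encode `k` edge-disjoint walks from `r` to `v`
in `F`; the right summand holds `k` markers separating the walks. -/
def Succession (tail head : E → α) (F : Set E) (r v : α) {κ : Type*} : E ⊕ κ → E ⊕ κ → Prop
  | .inl e, .inl f => e = f ∨ (f ∈ F ∧ tail f = head e)
  | .inl e, .inr _ => head e = v
  | .inr _, .inl f => f ∈ F ∧ tail f = r
  | .inr _, .inr _ => False

variable [Fintype E] {tail head : E → α} {F : Set E} {r v : α}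

theorem exists_injective_succession {k : ℕ} (hvr : v ≠ r)
    (h : ∀ X : Set α, r ∉ X → v ∈ X → k ≤ rho tail head F X) :
    ∃ σ : E ⊕ Fin k → E ⊕ Fin k, Function.Injective σ ∧
      ∀ x, Succession tail head F r v x (σ x) := by
  classical
  rw [← Fintype.all_card_le_filter_rel_iff_exists_injective]
  intro T
  have hl : ∀ e, Sum.inl e ∈ T → Sum.inl e ∈
      ({b | ∃ a ∈ T, Succession tail head F r v a b} : Finset (E ⊕ Fin k)) := fun e he => by
    simp only [Finset.mem_filter, Finset.mem_univ, true_and]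
    exact ⟨_, he, Or.inl rfl⟩
  by_cases hd : ∃ i, Sum.inr i ∈ T
  swap
  · refine Finset.card_le_card ?_
    rintro (e | i) hx
    · exact hl e hx
    · exact absurd ⟨i, hx⟩ hd
  obtain ⟨i, hi⟩ := hd
  have hT : T.card ≤ T.toLeft.card + k := by
    rw [← Finset.card_toLeft_add_card_toRight (u := T)]
    exact Nat.add_le_add_left (by simpa using Finset.card_le_univ T.toRight) _
  refine hT.trans ?_
  by_cases hv : ∃ e, Sum.inl e ∈ T ∧ head e = v
  · obtain ⟨e, he, hev⟩ := hv
    calc T.toLeft.card + k = (T.toLeft.disjSum (Finset.univ : Finset (Fin k))).card := by simp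
      _ ≤ _ := Finset.card_le_card (by
        rintro (f | j) hx
        · exact hl f (by simpa using hx)
        · simp only [Finset.mem_filter, Finset.mem_univ, true_and]
          exact ⟨_, he, hev⟩)
  let X : Set α := {a | a ≠ r ∧ ∀ e, Sum.inl e ∈ T → head e ≠ a}
  have hk := h X (fun hr => hr.1 rfl) ⟨hvr, fun e he hev => hv ⟨e, he, hev⟩⟩
  rw [rho, Set.ncard_eq_toFinset_card'] at hk
  calc T.toLeft.card + k
      ≤ T.toLeft.card + {e ∈ F | tail e ∉ X ∧ head e ∈ X}.toFinset.card :=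
        Nat.add_le_add_left hk _
    _ = (T.toLeft ∪ {e ∈ F | tail e ∉ X ∧ head e ∈ X}.toFinset).card := by
        refine (Finset.card_union_of_disjoint ?_).symm
        rw [Finset.disjoint_left]
        intro e he he'
        simp only [Set.mem_toFinset, Set.mem_ofPred_eq] at he'
        exact he'.2.2.2 e (by simpa using he) rfl
    _ = ((T.toLeft ∪ {e ∈ F | tail e ∉ X ∧ head e ∈ X}.toFinset).map
          Function.Embedding.inl).card := (Finset.card_map _).symm
    _ ≤ _ := Finset.card_le_card (by
        intro x hx
        obtain ⟨e, he, rfl⟩ := Finset.mem_map.1 hx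
        rcases Finset.mem_union.1 he with he | he
        · exact hl e (by simpa using he)
        · simp only [Set.mem_toFinset, Set.mem_ofPred_eq] at he
          obtain ⟨heF, ht, -⟩ := he
          simp only [Finset.mem_filter, Finset.mem_univ, true_and]
          by_cases htr : tail e = r
          · exact ⟨_, hi, heF, htr⟩
          · have : ∃ f, Sum.inl f ∈ T ∧ head f = tail e := by
              by_contra hne
              exact ht ⟨htr, fun f hf hfe => hne ⟨f, hf, hfe⟩⟩
            obtain ⟨f, hf, hfe⟩ := this
            exact ⟨_, hf, Or.inr ⟨heF, hfe.symm⟩⟩)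

theorem reachable_of_succession {κ : Type*} [Finite κ] {σ : E ⊕ κ → E ⊕ κ}
    (hσ : Function.Injective σ) (hs : ∀ x, Succession tail head F r v x (σ x)) (i : κ) :
    Relation.ReflTransGen
      (fun a b => ∃ e ∈ {e ∈ F | SegmentFrom σ i e}, tail e = a ∧ head e = b) r v := by
  by_contra hcon
  have key : ∀ n, ∃ e, σ^[n + 1] (Sum.inr i) = Sum.inl e ∧ e ∈ F ∧ SegmentFrom σ i e ∧
      Relation.ReflTransGen
        (fun a b => ∃ e ∈ {e ∈ F | SegmentFrom σ i e}, tail e = a ∧ head e = b) r (head e) := by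
    intro n
    induction n with
    | zero =>
      have h := hs (Sum.inr i)
      rcases hx : σ (Sum.inr i) with e | j
      · rw [hx] at h
        obtain ⟨heF, her⟩ := h
        exact ⟨e, hx, heF, .base hx, .single ⟨e, ⟨heF, .base hx⟩, her, rfl⟩⟩
      · rw [hx] at h
        exact h.elim
    | succ n ih =>
      obtain ⟨e, he, heF, heS, heR⟩ := ih
      have h := hs (Sum.inl e)
      rw [Function.iterate_succ_apply', he]
      rcases hx : σ (Sum.inl e) with f | j
      · rw [hx] at h
        have hfS := heS.step hx
        rcases h with rfl | ⟨hfF, hft⟩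
        · exact ⟨e, rfl, heF, heS, heR⟩
        · exact ⟨f, rfl, hfF, hfS, heR.tail ⟨f, ⟨hfF, hfS⟩, hft, rfl⟩⟩
      · rw [hx] at h
        have hev : head e = v := h
        exact absurd (hev ▸ heR) hcon
  obtain ⟨n, hn, hp⟩ := hσ.mem_periodicPts (Sum.inr i)
  obtain ⟨e, he, -⟩ := key (n - 1)
  rw [Nat.sub_add_cancel hn, hp.eq] at he
  simp at he

/-- Edge version of Menger's theorem. -/
theorem hasEDPaths_of_le_rho {k : ℕ} (hv : v ≠ r)
    (h : ∀ X : Set α, r ∉ X → v ∈ X → k ≤ rho tail head F X) :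
    HasEDPaths tail head F r v k := by
  obtain ⟨σ, hσ, hs⟩ := exists_injective_succession hv h
  choose P hP using fun i => exists_isRVPath (reachable_of_succession hσ hs i) hv.symm
  refine ⟨P, fun i => (hP i).mono (Set.sep_subset _ _), fun i j hij e hi hj => hij ?_⟩
  exact ((hP i).1 e hi).2.eq_of_injective hσ ((hP j).1 e hj).2

end Menger

section Flames

variable {α E : Type*} {tail head : E → α} {F : Set E} {r : α}

theorem rho_submodular [Finite E] (X Y : Set α) :
    rho tail head F (X ∪ Y) + rho tail head F (X ∩ Y) ≤
      rho tail head F X + rho tail head F Y := by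
  unfold rho
  rw [← Set.ncard_union_add_ncard_inter _ _ (Set.toFinite _) (Set.toFinite _),
    ← Set.ncard_union_add_ncard_inter {e ∈ F | tail e ∉ X ∧ head e ∈ X} _
      (Set.toFinite _) (Set.toFinite _)]
  refine Nat.add_le_add (Set.ncard_le_ncard ?_ (Set.toFinite _))
    (Set.ncard_le_ncard ?_ (Set.toFinite _)) <;>
  · intro e he
    simp only [Set.mem_union, Set.mem_inter_iff, Set.mem_ofPred_eq] at he ⊢
    tauto

theorem IsFlame.inDeg_le_rho [Finite E] (hF : IsFlame tail head F r) {v : α} {X : Set α}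
    (hr : r ∉ X) (hv : v ∈ X) : inDeg head F v ≤ rho tail head F X := by
  rw [← hF v (fun h => hr (h ▸ hv))]
  exact lam_le_rho hr hv

theorem IsFlame.insert_of_lt_rho [Fintype E] (hF : IsFlame tail head F r) {e : E} (he : e ∉ F)
    (h : ∀ X : Set α, r ∉ X → head e ∈ X → tail e ∈ X →
      inDeg head F (head e) < rho tail head F X) :
    IsFlame tail head (insert e F) r := by
  intro v hv
  refine (lam_le_inDeg hv).antisymm ?_
  by_cases hev : head e = v
  · subst hev
    have hdeg : inDeg head (insert e F) (head e) ≤ inDeg head F (head e) + 1 := by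
      refine le_trans (Set.ncard_le_ncard ?_ (Set.toFinite _)) (Set.ncard_insert_le e _)
      rintro f ⟨rfl | hf, hfe⟩
      · exact Or.inl rfl
      · exact Or.inr ⟨hf, hfe⟩
    refine hdeg.trans (HasEDPaths.le_lam hv (hasEDPaths_of_le_rho hv fun X hr hX => ?_))
    by_cases ht : tail e ∈ X
    · exact Nat.succ_le_of_lt ((h X hr hX ht).trans_le
        (Set.ncard_le_ncard (fun f hf => ⟨Or.inr hf.1, hf.2⟩) (Set.toFinite _)))
    · refine (Nat.succ_le_succ (hF.inDeg_le_rho hr hX)).trans ?_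
      unfold rho
      rw [Nat.succ_eq_add_one, ← Set.ncard_insert_of_notMem (a := e) (fun h => he h.1)
        (Set.toFinite _)]
      refine Set.ncard_le_ncard ?_ (Set.toFinite _)
      rintro f (rfl | hf)
      · exact ⟨Or.inl rfl, ht, hX⟩
      · exact ⟨Or.inr hf.1, hf.2⟩
  · calc inDeg head (insert e F) v ≤ inDeg head F v := by
          refine Set.ncard_le_ncard ?_ (Set.toFinite _)
          rintro f ⟨rfl | hf, hfe⟩
          · exact absurd hfe hev
          · exact ⟨hf, hfe⟩
      _ = lam tail head F r v := (hF v hv).symm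
      _ ≤ _ := lam_mono hv (Set.subset_insert _ _)

theorem exists_inDeg_lt [Fintype α] [Fintype E] {F₁ F₂ : Set E} (h : F₁.ncard < F₂.ncard) :
    ∃ v, inDeg head F₁ v < inDeg head F₂ v := by
  classical
  have hsum : ∀ F : Set E, F.ncard = ∑ v, inDeg head F v := by
    intro F
    rw [Set.ncard_eq_toFinset_card',
      Finset.card_eq_sum_card_fiberwise (f := head) (t := Finset.univ) (by simp)]
    refine Finset.sum_congr rfl fun v _ => ?_
    rw [inDeg, Set.ncard_eq_toFinset_card']
    congr 1
    ext e
    simp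
  by_contra! hle
  rw [hsum, hsum] at h
  exact absurd h (Finset.sum_le_sum fun v _ => hle v).not_gt

theorem isFlame_empty [Finite E] : IsFlame tail head (∅ : Set E) r := by
  intro v hv
  have h : inDeg head (∅ : Set E) v = 0 := by simp [inDeg]
  have := lam_le_inDeg (tail := tail) (head := head) (F := ∅) hv
  omega

end Flames

/-- the subflames of a rooted digraph `D = (V+r, E)` form a
greedoid on the ground set `E`: the empty edge set is a subflame, and for any
two subflames `F₁, F₂` with `|F₁| < |F₂|` there is an edge `e ∈ F₂ \ F₁` such
that `F₁ + e` is also a subflame. -/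
theorem subflames_form_greedoid
    {α E : Type*} [Fintype α] [Fintype E] (tail head : E → α) (r : α) :
    IsFlame tail head (∅ : Set E) r ∧
    ∀ F₁ F₂ : Set E, IsFlame tail head F₁ r → IsFlame tail head F₂ r →
      F₁.ncard < F₂.ncard →
      ∃ e ∈ F₂ \ F₁, IsFlame tail head (insert e F₁) r := by
  refine ⟨isFlame_empty, fun F₁ F₂ h₁ h₂ hlt => ?_⟩
  by_contra! hbad
  have htight : ∀ e ∈ F₂ \ F₁, ∃ X : Set α, r ∉ X ∧ head e ∈ X ∧ tail e ∈ X ∧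
      rho tail head F₁ X ≤ inDeg head F₁ (head e) := by
    intro e he
    by_contra! hno
    exact hbad e he (h₁.insert_of_lt_rho he.2 hno)
  obtain ⟨w, hw⟩ := exists_inDeg_lt (head := head) hlt
  have hwr : w ≠ r := by
    rintro rfl
    obtain ⟨e, he, he'⟩ := Set.exists_mem_notMem_of_ncard_lt_ncard hw (Set.toFinite _)
    obtain ⟨X, hr, hX, -⟩ := htight e ⟨he.1, fun h => he' ⟨h, he.2⟩⟩
    exact hr (he.2 ▸ hX)
  obtain ⟨X, hX⟩ := Set.Finite.exists_maximal
    (s := {X : Set α | r ∉ X ∧ w ∈ X ∧ rho tail head F₁ X ≤ inDeg head F₁ w}) (Set.toFinite _)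
    ⟨{w}, by simpa using hwr.symm, rfl, rho_singleton_le_inDeg⟩
  obtain ⟨hrX, hwX, hρX⟩ := hX.prop
  obtain ⟨e, he, he'⟩ := Set.exists_mem_notMem_of_ncard_lt_ncard
    (hρX.trans_lt (hw.trans_le (h₂.inDeg_le_rho hrX hwX))) (Set.toFinite _)
  obtain ⟨Y, hrY, hhY, htY, hρY⟩ := htight e ⟨he.1, fun h => he' ⟨h, he.2⟩⟩
  have hinter := h₁.inDeg_le_rho (v := head e) (X := X ∩ Y) (fun h => hrX h.1) ⟨he.2.2, hhY⟩
  have hsub := rho_submodular (tail := tail) (head := head) (F := F₁) X Y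
  have hunion : X ∪ Y ⊆ X := hX.le_of_ge
    ⟨fun h => h.elim hrX hrY, Or.inl hwX, by omega⟩ Set.subset_union_left
  exact he.2.1 (hunion (Or.inr htY))
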